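/- Let m ∈ ℕ and let (b_α)_{|α| ≤ m} be complex numbers with b_{g₀} a nonnegative real number. Then the following are equivalent: (i) there exist complex numbers (b_α)_{|α| ≥ m+1} such that the coefficient family c defined by c_{g₀} := b_{g₀}/2 and c_α := b_α for |α| ≥ 1 satisfies the radius-1 limsup condition and its associated free holomorphic function g satisfies g_K(X) + g_K(X)* ≥ 0 for every complex Hilbert space K and every X ∈ [B(K)ⁿ]₁; (ii) the operator Σ_{1 ≤ |α| ≤ m} conj(b_α) (S_α^(m))* + b_{g₀} I + Σ_{1 ≤ |α| ≤ m} b_α S_α^(m) on P^(m) is a positive operator. -/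

import Mathlib

open scoped ENNReal ComplexOrder
open Filter ContinuousLinearMap

noncomputable section

abbrev Word (n : ℕ) := FreeMonoid (Fin n)

/-- The word determined by a tuple of letters. -/
def word {n k : ℕ} (f : Fin k → Fin n) : Word n :=
  FreeMonoid.ofList (List.ofFn f)

/-- The length of a word. -/
def wordLen {n : ℕ} (α : Word n) : ℕ := (FreeMonoid.toList α).length

/-- The product `X_α = X_{i₁} ⋯ X_{i_k}` for `α = g_{i₁} ⋯ g_{i_k}`. -/
def wordProd {n : ℕ} {K : Type} [NormedAddCommGroup K] [InnerProductSpace ℂ K]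
    (X : Fin n → K →L[ℂ] K) (α : Word n) : K →L[ℂ] K :=
  ((FreeMonoid.toList α).map X).prod

/-- `Σ_{|α| = k} a_α X_α`. -/
def truncSum {n : ℕ} {K : Type} [NormedAddCommGroup K] [InnerProductSpace ℂ K]
    (a : Word n → ℂ) (X : Fin n → K →L[ℂ] K) (k : ℕ) : K →L[ℂ] K :=
  ∑ f : Fin k → Fin n, a (word f) • wordProd X (word f)

/-- `Σ_{|α| = k} b_α X_α*`. -/
def truncSumAdj {n : ℕ} {K : Type} [NormedAddCommGroup K] [InnerProductSpace ℂ K]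
    [CompleteSpace K] (b : Word n → ℂ) (X : Fin n → K →L[ℂ] K) (k : ℕ) : K →L[ℂ] K :=
  ∑ f : Fin k → Fin n, b (word f) • adjoint (wordProd X (word f))

/-- The free holomorphic function `f(X) = Σ_k Σ_{|α| = k} a_α X_α`. -/
def holOp {n : ℕ} {K : Type} [NormedAddCommGroup K] [InnerProductSpace ℂ K]
    (a : Word n → ℂ) (X : Fin n → K →L[ℂ] K) : K →L[ℂ] K :=
  ∑' k : ℕ, truncSum a X k

/-- The free pluriharmonic function
`u(X) = Σ_{k ≥ 1} Σ_{|α| = k} b_α X_α* + a_{g₀} I + Σ_{k ≥ 1} Σ_{|α| = k} a_α X_α`. -/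
def phOp {n : ℕ} {K : Type} [NormedAddCommGroup K] [InnerProductSpace ℂ K]
    [CompleteSpace K] (a b : Word n → ℂ) (X : Fin n → K →L[ℂ] K) : K →L[ℂ] K :=
  (∑' k : ℕ, truncSumAdj b X (k + 1)) + a 1 • (1 : K →L[ℂ] K)
    + ∑' k : ℕ, truncSum a X (k + 1)

/-- Membership in the open noncommutative ball of radius `γ`. -/
def inBall {n : ℕ} {K : Type} [NormedAddCommGroup K] [InnerProductSpace ℂ K]
    [CompleteSpace K] (γ : ℝ) (X : Fin n → K →L[ℂ] K) : Prop :=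
  ‖∑ i, X i * adjoint (X i)‖ < γ ^ 2

/-- Membership in the closed noncommutative ball of radius `γ`. -/
def inClosedBall {n : ℕ} {K : Type} [NormedAddCommGroup K] [InnerProductSpace ℂ K]
    [CompleteSpace K] (γ : ℝ) (X : Fin n → K →L[ℂ] K) : Prop :=
  ‖∑ i, X i * adjoint (X i)‖ ≤ γ ^ 2

/-- The radius-`γ` condition `limsup_k (Σ_{|α|=k} |a_α|²)^{1/(2k)} ≤ 1/γ`. -/
def radCond {n : ℕ} (γ : ℝ) (a : Word n → ℂ) : Prop :=
  Filter.limsup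
    (fun k : ℕ =>
      (∑ f : Fin k → Fin n, (‖a (word f)‖₊ : ℝ≥0∞) ^ 2) ^ ((1 : ℝ) / (2 * (k : ℝ))))
    Filter.atTop ≤ ENNReal.ofReal (1 / γ)

/-- The coefficients of the radial function: `α ↦ r^{|α|} a_α`. -/
def scaleCoef {n : ℕ} (r : ℝ) (a : Word n → ℂ) : Word n → ℂ :=
  fun α => ((r : ℂ) ^ wordLen α) * a α

/-- Positivity of the free pluriharmonic function with coefficients `(a, b)` on the
noncommutative ball of radius `γ` of every complex Hilbert space. -/
def posPH {n : ℕ} (γ : ℝ) (a b : Word n → ℂ) : Prop :=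
  ∀ (K : Type) [NormedAddCommGroup K] [InnerProductSpace ℂ K] [CompleteSpace K],
    ∀ X : Fin n → K →L[ℂ] K, inBall γ X → (phOp a b X).IsPositive


open scoped TensorProduct InnerProductSpace

lemma word_cons {n k : ℕ} (i : Fin n) (f : Fin k → Fin n) :
    word (Fin.cons i f : Fin (k+1) → Fin n) = FreeMonoid.of i * word f := by
  simp [word, List.ofFn_succ, FreeMonoid.ofList_cons]

lemma wordLen_word {n k : ℕ} (f : Fin k → Fin n) : wordLen (word f) = k := by
  simp [word, wordLen]

lemma wordLen_mul {n : ℕ} (a c : Word n) : wordLen (a * c) = wordLen a + wordLen c := by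
  simp [wordLen]

lemma wordLen_of {n : ℕ} (i : Fin n) : wordLen (FreeMonoid.of i) = 1 := by
  simp [wordLen]

lemma wordLen_one {n : ℕ} : wordLen (1 : Word n) = 0 := by
  simp [wordLen]

lemma wordLen_eq_zero {n : ℕ} {a : Word n} (h : wordLen a = 0) : a = 1 := by
  exact FreeMonoid.toList.injective (List.eq_nil_of_length_eq_zero h)

lemma clm_mul_apply {E : Type*} [NormedAddCommGroup E] [InnerProductSpace ℂ E]
    (A B : E →L[ℂ] E) (x : E) : (A * B) x = A (B x) := rfl

lemma nsq {E : Type*} [NormedAddCommGroup E] [InnerProductSpace ℂ E] (y : E) :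
    ‖y‖ ^ 2 = ‖⟪y, y⟫_ℂ‖ := by
  rw [inner_self_eq_norm_sq_to_K]; simp

section ops
variable {n : ℕ} {K : Type} [NormedAddCommGroup K] [InnerProductSpace ℂ K]

lemma wordProd_one (X : Fin n → K →L[ℂ] K) : wordProd X 1 = 1 := by
  simp [wordProd]

lemma wordProd_of_mul (X : Fin n → K →L[ℂ] K) (i : Fin n) (a : Word n) :
    wordProd X (FreeMonoid.of i * a) = X i * wordProd X a := by
  simp [wordProd]

lemma sum_cons {M : Type*} [AddCommMonoid M] {k : ℕ} (g : (Fin (k+1) → Fin n) → M) :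
    ∑ f, g f = ∑ i : Fin n, ∑ f : Fin k → Fin n, g (Fin.cons i f) := by
  rw [← Fintype.sum_prod_type']
  exact (Fintype.sum_equiv (Fin.consEquiv (fun _ => Fin n)) _ _ (fun x => rfl)).symm

lemma truncSum_zero (a : Word n → ℂ) (X : Fin n → K →L[ℂ] K) : truncSum a X 0 = a 1 • 1 := by
  have : ∀ f : Fin 0 → Fin n, word f = 1 := fun f => by simp [word]
  simp [truncSum, this, wordProd_one]

lemma adjoint_truncSum [CompleteSpace K] (a : Word n → ℂ) (X : Fin n → K →L[ℂ] K) (k : ℕ) :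
    adjoint (truncSum a X k) = truncSumAdj (fun α => (starRingEnd ℂ) (a α)) X k := by
  simp only [truncSum, truncSumAdj, map_sum]
  exact Finset.sum_congr rfl fun f _ => LinearIsometryEquiv.map_smulₛₗ _ _ _

/-- Cauchy-Schwarz for rows. -/
lemma row_bound [CompleteSpace K] (X : Fin n → K →L[ℂ] K) (r : ℝ) (hr : 0 ≤ r)
    (h : ∀ x, ∑ i, ‖adjoint (X i) x‖ ^ 2 ≤ r ^ 2 * ‖x‖ ^ 2) :
    ‖∑ i, X i * adjoint (X i)‖ ≤ r ^ 2 := by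
  refine opNorm_le_bound _ (by positivity) fun x => ?_
  set y := (∑ i, X i * adjoint (X i)) x with hy
  have h1 : ‖y‖ ^ 2 ≤ (r * ‖x‖) * (r * ‖y‖) := by
    calc ‖y‖ ^ 2 = ‖⟪y, y⟫_ℂ‖ := nsq y
      _ = ‖∑ i, ⟪adjoint (X i) x, adjoint (X i) y⟫_ℂ‖ := by
          congr 1
          nth_rw 1 [hy]
          simp only [_root_.sum_apply, clm_mul_apply, sum_inner, adjoint_inner_right]
      _ ≤ ∑ i, ‖adjoint (X i) x‖ * ‖adjoint (X i) y‖ :=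
          (norm_sum_le _ _).trans (Finset.sum_le_sum fun i _ => norm_inner_le_norm _ _)
      _ ≤ √(∑ i, ‖adjoint (X i) x‖ ^ 2) * √(∑ i, ‖adjoint (X i) y‖ ^ 2) :=
          Real.sum_mul_le_sqrt_mul_sqrt _ _ _
      _ ≤ (r * ‖x‖) * (r * ‖y‖) := by
          gcongr
          · exact Real.sqrt_le_iff.2 ⟨by positivity, (h x).trans (by rw [mul_pow])⟩
          · exact Real.sqrt_le_iff.2 ⟨by positivity, (h y).trans (by rw [mul_pow])⟩
  rcases (norm_nonneg y).eq_or_lt with h0 | h0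
  · rw [← h0]; positivity
  · nlinarith

lemma ball_bound [CompleteSpace K] (X : Fin n → K →L[ℂ] K) (x : K) :
    ∑ i, ‖adjoint (X i) x‖ ^ 2 ≤ ‖∑ i, X i * adjoint (X i)‖ * ‖x‖ ^ 2 := by
  have : (∑ i, ‖adjoint (X i) x‖ ^ 2 : ℝ) = ‖⟪x, (∑ i, X i * adjoint (X i)) x⟫_ℂ‖ := by
    have h2 : ⟪x, (∑ i, X i * adjoint (X i)) x⟫_ℂ = ((∑ i, ‖adjoint (X i) x‖ ^ 2 : ℝ) : ℂ) := by
      simp only [_root_.sum_apply, clm_mul_apply, inner_sum]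
      push_cast
      refine Finset.sum_congr rfl fun i _ => ?_
      rw [← adjoint_inner_left, inner_self_eq_norm_sq_to_K]; rfl
    rw [h2, Complex.norm_real, Real.norm_of_nonneg (by positivity)]
  rw [this]
  calc _ ≤ ‖x‖ * ‖(∑ i, X i * adjoint (X i)) x‖ := norm_inner_le_norm _ _
    _ ≤ ‖x‖ * (‖∑ i, X i * adjoint (X i)‖ * ‖x‖) := by gcongr; exact le_opNorm _ _
    _ = _ := by ring

end ops

section tens
variable {n : ℕ} {G H : Type} [NormedAddCommGroup G] [InnerProductSpace ℂ G]
  [NormedAddCommGroup H] [InnerProductSpace ℂ H]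

lemma rTensor_col (D : Fin n → H →L[ℂ] H) (M : ℝ) (hM : 0 ≤ M)
    (h : ∀ x, ∑ i, ‖D i x‖ ^ 2 ≤ M ^ 2 * ‖x‖ ^ 2) (y : H ⊗[ℂ] G) :
    ∑ i, ‖(D i).rTensor G y‖ ^ 2 ≤ M ^ 2 * ‖y‖ ^ 2 := by
  let D' : H →ₗ[ℂ] PiLp 2 (fun _ : Fin n => H) :=
    { toFun := fun x => WithLp.toLp 2 (fun i => D i x)
      map_add' := fun x y => by ext i; simp
      map_smul' := fun c x => by ext i; simp }
  let DD : H →L[ℂ] PiLp 2 (fun _ : Fin n => H) := D'.mkContinuous M (fun x => by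
    rw [PiLp.norm_eq_of_L2]
    exact Real.sqrt_le_iff.2 ⟨by positivity, (h x).trans (by rw [mul_pow])⟩)
  have hDD : ‖DD‖ ≤ M := LinearMap.mkContinuous_norm_le _ hM _
  have key : ∑ i, ‖(D i).rTensor G y‖ ^ 2 = ‖DD.rTensor G y‖ ^ 2 := by
    obtain ⟨N, e, g, rfl⟩ := TensorProduct.exists_sum_tmul_eq y
    have e1 : ∀ p q, ⟪DD p, DD q⟫_ℂ = ∑ i, ⟪D i p, D i q⟫_ℂ := fun p q => by
      rw [PiLp.inner_apply]; rfl
    have : (((∑ i, ‖(D i).rTensor G (∑ j, e j ⊗ₜ[ℂ] g j)‖ ^ 2 : ℝ)) : ℂ)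
      = ((‖DD.rTensor G (∑ j, e j ⊗ₜ[ℂ] g j)‖ ^ 2 : ℝ) : ℂ) := by
      push_cast
      have t : ∀ {E : Type} [NormedAddCommGroup E] [InnerProductSpace ℂ E] (z : E),
        (‖z‖ : ℂ) ^ 2 = ⟪z, z⟫_ℂ := fun z => (inner_self_eq_norm_sq_to_K (𝕜 := ℂ) z).symm
      simp only [t, map_sum, ContinuousLinearMap.rTensor_tmul, sum_inner, inner_sum,
        TensorProduct.inner_tmul, e1]
      rw [Finset.sum_comm]
      refine Finset.sum_congr rfl fun p _ => ?_
      rw [Finset.sum_comm]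
      refine Finset.sum_congr rfl fun q _ => ?_
      rw [Finset.sum_mul]
    exact_mod_cast this
  rw [key, ← mul_pow]
  gcongr
  exact (le_opNorm _ _).trans (by gcongr; exact (ContinuousLinearMap.norm_rTensor_le _ _).trans hDD)

lemma lTensor_col (D : Fin n → H →L[ℂ] H) (M : ℝ) (hM : 0 ≤ M)
    (h : ∀ x, ∑ i, ‖D i x‖ ^ 2 ≤ M ^ 2 * ‖x‖ ^ 2) (y : G ⊗[ℂ] H) :
    ∑ i, ‖(D i).lTensor G y‖ ^ 2 ≤ M ^ 2 * ‖y‖ ^ 2 := by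
  have := rTensor_col D M hM h (TensorProduct.commIsometry ℂ G H y)
  rw [LinearIsometryEquiv.norm_map] at this
  convert this using 3 with i
  exact LinearIsometryEquiv.norm_map (TensorProduct.commIsometry ℂ H G) _

lemma inner_rTensor_adj [CompleteSpace G] (X : G →L[ℂ] G) (z w : G ⊗[ℂ] H) :
    ⟪w, X.rTensor H z⟫_ℂ = ⟪(adjoint X).rTensor H w, z⟫_ℂ := by
  induction z using TensorProduct.induction_on with
  | zero => simp
  | add a c ha hc => rw [map_add, inner_add_right, ha, hc, inner_add_right]
  | tmul k h =>
    induction w using TensorProduct.induction_on with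
    | zero => simp
    | add a c ha hc => rw [map_add, inner_add_left, ha, hc, inner_add_left]
    | tmul k' h' =>
      simp only [ContinuousLinearMap.rTensor_tmul, TensorProduct.inner_tmul, adjoint_inner_left]

/-- `R = Σ X_i ⊗ C_i`. -/
def RR (X : Fin n → G →L[ℂ] G) (C : Fin n → H →L[ℂ] H) : G ⊗[ℂ] H →L[ℂ] G ⊗[ℂ] H :=
  ∑ i, (X i).rTensor H ∘L (C i).lTensor G

lemma RR_bound [CompleteSpace G] (X : Fin n → G →L[ℂ] G) (C : Fin n → H →L[ℂ] H) (r : ℝ)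
    (hr : 0 ≤ r) (hX : ∀ x, ∑ i, ‖adjoint (X i) x‖ ^ 2 ≤ r ^ 2 * ‖x‖ ^ 2)
    (hC : ∀ h, ∑ i, ‖C i h‖ ^ 2 ≤ ‖h‖ ^ 2) (z : G ⊗[ℂ] H) : ‖RR X C z‖ ≤ r * ‖z‖ := by
  set y := RR X C z with hy
  have h1 : ‖y‖ ^ 2 ≤ (r * ‖y‖) * (1 * ‖z‖) := by
    calc ‖y‖ ^ 2 = ‖⟪y, y⟫_ℂ‖ := nsq y
      _ = ‖∑ i, ⟪(adjoint (X i)).rTensor H y, (C i).lTensor G z⟫_ℂ‖ := by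
          congr 1
          nth_rw 2 [hy]
          rw [RR]
          simp only [_root_.sum_apply, inner_sum, ContinuousLinearMap.comp_apply,
            inner_rTensor_adj]
      _ ≤ ∑ i, ‖(adjoint (X i)).rTensor H y‖ * ‖(C i).lTensor G z‖ :=
          (norm_sum_le _ _).trans (Finset.sum_le_sum fun i _ => norm_inner_le_norm _ _)
      _ ≤ √(∑ i, ‖(adjoint (X i)).rTensor H y‖ ^ 2) * √(∑ i, ‖(C i).lTensor G z‖ ^ 2) :=
          Real.sum_mul_le_sqrt_mul_sqrt _ _ _
      _ ≤ (r * ‖y‖) * (1 * ‖z‖) := by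
          gcongr
          · exact Real.sqrt_le_iff.2 ⟨by positivity,
              (rTensor_col _ r hr hX y).trans (by rw [mul_pow])⟩
          · exact Real.sqrt_le_iff.2 ⟨by positivity,
              (lTensor_col _ 1 zero_le_one (by simpa using hC) z).trans (by rw [mul_pow])⟩
  rcases (norm_nonneg y).eq_or_lt with h0 | h0
  · rw [← h0]; positivity
  · nlinarith

lemma RR_tmul (X : Fin n → G →L[ℂ] G) (C : Fin n → H →L[ℂ] H) (x : G) (h : H) :
    RR X C (x ⊗ₜ h) = ∑ i, X i x ⊗ₜ[ℂ] C i h := by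
  simp only [RR, _root_.sum_apply, ContinuousLinearMap.comp_apply,
    ContinuousLinearMap.lTensor_tmul, ContinuousLinearMap.rTensor_tmul]

lemma RR_pow (X : Fin n → G →L[ℂ] G) (C : Fin n → H →L[ℂ] H) (x : G) (h : H) (k : ℕ) :
    (RR X C ^ k) (x ⊗ₜ h) =
      ∑ f : Fin k → Fin n, wordProd X (word f) x ⊗ₜ[ℂ] wordProd C (word f) h := by
  induction k with
  | zero =>
    have : ∀ f : Fin 0 → Fin n, word f = 1 := fun f => by simp [word]
    simp [this, wordProd_one]
  | succ k ih =>
    rw [pow_succ', clm_mul_apply, ih, map_sum, sum_cons, Finset.sum_comm]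
    refine Finset.sum_congr rfl fun f _ => ?_
    rw [RR_tmul]
    simp [word_cons, wordProd_of_mul]

end tens

lemma isPos_add_adj {K : Type} [NormedAddCommGroup K] [InnerProductSpace ℂ K] [CompleteSpace K]
    (A : K →L[ℂ] K) (h : ∀ x : K, 0 ≤ (⟪x, A x⟫_ℂ).re) : (A + adjoint A).IsPositive := by
  rw [isPositive_iff_complex]
  intro x
  have e : ⟪(A + adjoint A) x, x⟫_ℂ = ((2 * (⟪x, A x⟫_ℂ).re : ℝ) : ℂ) := by
    rw [_root_.add_apply, inner_add_left, adjoint_inner_left, ← inner_conj_symm,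
      add_comm, Complex.add_conj]
  rw [e]
  have := h x
  constructor
  · simp
  · simpa using this

lemma re_of_isPos_add_adj {K : Type} [NormedAddCommGroup K] [InnerProductSpace ℂ K]
    [CompleteSpace K]
    (A : K →L[ℂ] K) (h : (A + adjoint A).IsPositive) (x : K) : 0 ≤ (⟪x, A x⟫_ℂ).re := by
  rw [isPositive_iff_complex] at h
  have e : ⟪(A + adjoint A) x, x⟫_ℂ = ((2 * (⟪x, A x⟫_ℂ).re : ℝ) : ℂ) := by
    rw [_root_.add_apply, inner_add_left, adjoint_inner_left, ← inner_conj_symm,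
      add_comm, Complex.add_conj]
  have := (h x).2
  rw [e] at this
  simpa using this

lemma neumann_pos {E : Type*} [NormedAddCommGroup E] [InnerProductSpace ℂ E] (R : E →L[ℂ] E)
    (r : ℝ) (hr : 0 ≤ r) (hr1 : r < 1) (hR : ∀ z, ‖R z‖ ≤ r * ‖z‖) (u : E) (S : ℂ)
    (hS : Tendsto (fun N => ∑ k ∈ Finset.range N, ⟪u, (R ^ k) u⟫_ℂ) atTop (nhds S)) :
    ‖u‖ ^ 2 ≤ 2 * S.re := by
  have hp : ∀ k, ‖(R ^ k) u‖ ≤ r ^ k * ‖u‖ := by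
    intro k
    induction k with
    | zero => simp
    | succ k ih =>
      rw [pow_succ', clm_mul_apply]
      calc _ ≤ r * ‖(R ^ k) u‖ := hR _
        _ ≤ r * (r ^ k * ‖u‖) := by gcongr
        _ = _ := by ring
  let y : ℕ → E := fun N => ∑ k ∈ Finset.range N, (R ^ k) u
  let w : ℕ → E := fun N => (R ^ N) u
  have hyb : ∀ N, ‖y N‖ ≤ N * ‖u‖ := by
    intro N
    refine (norm_sum_le_of_le _ (fun k _ => (hp k).trans
      (mul_le_of_le_one_left (norm_nonneg _) (pow_le_one₀ hr hr1.le)))).trans ?_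
    simp
  have htel : ∀ N, y N - R (y N) = u - w N := by
    intro N
    induction N with
    | zero => simp [y, w]
    | succ N ih =>
      have e1 : y (N+1) = y N + w N := Finset.sum_range_succ _ _
      have e2 : w (N+1) = R (w N) := by simp only [w]; rw [pow_succ', clm_mul_apply]
      rw [e1, e2, map_add]
      calc _ = (y N - R (y N)) + w N - R (w N) := by abel
        _ = _ := by rw [ih]; abel
  have hw : Tendsto w atTop (nhds 0) := by
    refine squeeze_zero_norm (a := fun N => r ^ N * ‖u‖) (fun N => hp N) ?_
    simpa using (tendsto_pow_atTop_nhds_zero_of_lt_one hr hr1).mul_const ‖u‖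
  have hyw : Tendsto (fun N => ⟪y N, w N⟫_ℂ) atTop (nhds 0) := by
    refine squeeze_zero_norm (a := fun N : ℕ => (N * r ^ N) * ‖u‖ ^ 2) (fun N => ?_) ?_
    · calc _ ≤ ‖y N‖ * ‖w N‖ := norm_inner_le_norm _ _
        _ ≤ (N * ‖u‖) * (r ^ N * ‖u‖) := by
          gcongr
          · exact hyb N
          · exact hp N
        _ = _ := by ring
    · simpa using (tendsto_self_mul_const_pow_of_lt_one hr hr1).mul_const (‖u‖ ^ 2)
  have hin : ∀ N, ‖u - w N‖ ^ 2 ≤ 2 * ((⟪u, y N⟫_ℂ).re - (⟪y N, w N⟫_ℂ).re) := by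
    intro N
    have h1 : ‖R (y N)‖ ^ 2 ≤ ‖y N‖ ^ 2 := by
      gcongr
      exact (hR _).trans (mul_le_of_le_one_left (norm_nonneg _) hr1.le)
    have h2 : R (y N) = y N - (u - w N) := by rw [← htel]; abel
    rw [h2, @norm_sub_sq ℂ] at h1
    have h3 : RCLike.re ⟪y N, u - w N⟫_ℂ = (⟪u, y N⟫_ℂ).re - (⟪y N, w N⟫_ℂ).re := by
      rw [inner_sub_right, map_sub]
      congr 1
      exact inner_re_symm (𝕜 := ℂ) _ _
    linarith
  have hl : Tendsto (fun N => ‖u - w N‖ ^ 2) atTop (nhds (‖u‖ ^ 2)) := by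
    have := ((tendsto_const_nhds (x := u)).sub hw).norm.pow 2
    simpa using this
  have hy : Tendsto (fun N => ⟪u, y N⟫_ℂ) atTop (nhds S) := by
    simpa only [y, inner_sum] using hS
  have hrr : Tendsto (fun N => 2 * ((⟪u, y N⟫_ℂ).re - (⟪y N, w N⟫_ℂ).re)) atTop
      (nhds (2 * (S.re - (0:ℂ).re))) :=
    (((Complex.continuous_re.tendsto _).comp hy).sub
      ((Complex.continuous_re.tendsto _).comp hyw)).const_mul 2
  have := le_of_tendsto_of_tendsto' hl hrr hin
  simpa using this

section suff
variable {n : ℕ} {H : Type} [NormedAddCommGroup H] [InnerProductSpace ℂ H]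
  (C : Fin n → H →L[ℂ] H) (v : H)

/-- coefficients `⟨v, C_α v⟩`. -/
def dC : Word n → ℂ := fun α => ⟪v, wordProd C α v⟫_ℂ

lemma col_pow (hC : ∀ h, ∑ i, ‖C i h‖ ^ 2 ≤ ‖h‖ ^ 2) (k : ℕ) :
    ∑ f : Fin k → Fin n, ‖wordProd C (word f) v‖ ^ 2 ≤ ‖v‖ ^ 2 := by
  induction k with
  | zero =>
    have : ∀ f : Fin 0 → Fin n, word f = 1 := fun f => by simp [word]
    simp [this, wordProd_one]
  | succ k ih =>
    rw [sum_cons, Finset.sum_comm]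
    refine le_trans (Finset.sum_le_sum fun f _ => ?_) ih
    simpa only [word_cons, wordProd_of_mul, clm_mul_apply] using hC (wordProd C (word f) v)

lemma radCond_of (hC : ∀ h, ∑ i, ‖C i h‖ ^ 2 ≤ ‖h‖ ^ 2) (c : Word n → ℂ)
    (hc : ∀ α, 1 ≤ wordLen α → c α = dC C v α) : radCond 1 c := by
  unfold radCond
  simp only [div_one, ENNReal.ofReal_one]
  set M : ℝ≥0∞ := max 1 (ENNReal.ofReal (‖v‖ ^ 2 * ‖v‖ ^ 2)) with hM
  have hM1 : 1 ≤ M := le_max_left _ _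
  have hMt : M ≠ ⊤ := (max_lt ENNReal.one_lt_top ENNReal.ofReal_lt_top).ne
  have hlim : Tendsto (fun k : ℕ => M ^ ((1:ℝ) / (2 * (k:ℝ)))) atTop (nhds 1) := by
    have h0 : Tendsto (fun k : ℕ => (1:ℝ) / (2 * (k:ℝ))) atTop (nhds 0) := by
      simp only [one_div]
      exact ((tendsto_natCast_atTop_atTop (R := ℝ)).const_mul_atTop two_pos).inv_tendsto_atTop
    have : M = ENNReal.ofReal M.toReal := (ENNReal.ofReal_toReal hMt).symm
    have hpos : 0 < M.toReal := ENNReal.toReal_pos (by positivity) hMt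
    rw [this]
    simp_rw [ENNReal.ofReal_rpow_of_pos hpos]
    rw [← ENNReal.ofReal_one]
    refine ENNReal.tendsto_ofReal ?_
    simpa [Function.comp_def] using ((Real.continuousAt_const_rpow (a := M.toReal) (b := 0) hpos.ne').tendsto).comp h0
  rw [← hlim.limsup_eq]
  refine limsup_le_limsup ?_
  filter_upwards [eventually_ge_atTop 1] with k hk
  gcongr
  refine le_trans ?_ (le_max_right _ _)
  calc ∑ f : Fin k → Fin n, (‖c (word f)‖₊ : ℝ≥0∞) ^ 2
      = ENNReal.ofReal (∑ f : Fin k → Fin n, ‖c (word f)‖ ^ 2) := by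
        rw [ENNReal.ofReal_sum_of_nonneg (fun _ _ => by positivity)]
        refine Finset.sum_congr rfl fun f _ => ?_
        rw [ENNReal.ofReal_pow (norm_nonneg _), ofReal_norm]; rfl
    _ ≤ _ := by
        refine ENNReal.ofReal_le_ofReal ?_
        calc _ ≤ ∑ f : Fin k → Fin n, ‖v‖ ^ 2 * ‖wordProd C (word f) v‖ ^ 2 := by
              refine Finset.sum_le_sum fun f _ => ?_
              rw [hc _ (by rw [wordLen_word]; exact hk), ← mul_pow]
              gcongr
              exact norm_inner_le_norm _ _
          _ ≤ _ := by
              rw [← Finset.mul_sum]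
              gcongr
              exact col_pow C v hC k

lemma pos_of (hC : ∀ h, ∑ i, ‖C i h‖ ^ 2 ≤ ‖h‖ ^ 2) (c : Word n → ℂ)
    (hc : ∀ α, 1 ≤ wordLen α → c α = dC C v α) (hc1 : c 1 = ((‖v‖ ^ 2 / 2 : ℝ) : ℂ))
    (K : Type) [NormedAddCommGroup K] [InnerProductSpace ℂ K] [CompleteSpace K]
    (X : Fin n → K →L[ℂ] K) (hX : inBall 1 X) :
    (holOp c X + adjoint (holOp c X)).IsPositive := by
  set q := ‖∑ i, X i * adjoint (X i)‖ with hq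
  have hq1 : q < 1 := by simpa [inBall] using hX
  have hq0 : 0 ≤ q := norm_nonneg _
  have hr1 : √q < 1 := by rw [Real.sqrt_lt' one_pos]; simpa using hq1
  have hXr : ∀ x, ∑ i, ‖adjoint (X i) x‖ ^ 2 ≤ (√q) ^ 2 * ‖x‖ ^ 2 := fun x => by
    rw [Real.sq_sqrt hq0]; exact ball_bound X x
  have hR := RR_bound X C (√q) (Real.sqrt_nonneg _) hXr hC
  have hRp : ∀ (k : ℕ) z, ‖(RR X C ^ k) z‖ ≤ √q ^ k * ‖z‖ := by
    intro k z
    induction k with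
    | zero => simp
    | succ k ih =>
      rw [pow_succ', clm_mul_apply]
      calc _ ≤ √q * ‖(RR X C ^ k) z‖ := hR _
        _ ≤ √q * (√q ^ k * ‖z‖) := by gcongr
        _ = _ := by ring
  have hinner : ∀ (k : ℕ) (w x : K), ⟪w, truncSum (dC C v) X k x⟫_ℂ =
      ⟪w ⊗ₜ[ℂ] v, (RR X C ^ k) (x ⊗ₜ[ℂ] v)⟫_ℂ := by
    intro k w x
    rw [RR_pow, inner_sum]
    simp only [truncSum, _root_.sum_apply, inner_sum, TensorProduct.inner_tmul,
      _root_.smul_apply, inner_smul_right, dC]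
    exact Finset.sum_congr rfl fun f _ => mul_comm _ _
  have hnorm : ∀ k, ‖truncSum (dC C v) X k‖ ≤ √q ^ k * ‖v‖ ^ 2 := by
    intro k
    refine opNorm_le_bound _ (by positivity) fun x => ?_
    set y := truncSum (dC C v) X k x with hy
    have h1 : ‖y‖ ^ 2 ≤ (‖y‖ * ‖v‖) * (√q ^ k * (‖x‖ * ‖v‖)) := by
      rw [nsq y]
      nth_rw 2 [hy]
      rw [hinner]
      refine (norm_inner_le_norm (𝕜 := ℂ) (E := K ⊗[ℂ] H) _ _).trans ?_
      rw [TensorProduct.norm_tmul]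
      gcongr
      refine (hRp _ _).trans ?_
      rw [TensorProduct.norm_tmul]
    rcases (norm_nonneg y).eq_or_lt with h0 | h0
    · rw [← h0]; positivity
    · have : ‖y‖ * ‖y‖ ≤ ‖y‖ * (√q ^ k * ‖v‖ ^ 2 * ‖x‖) := by nlinarith
      exact le_of_mul_le_mul_left this h0
  have hsum : Summable (truncSum (dC C v) X) :=
    Summable.of_norm_bounded ((summable_geometric_of_lt_one (Real.sqrt_nonneg _) hr1).mul_right _)
      hnorm
  have hd1 : dC C v 1 = ((‖v‖ ^ 2 : ℝ) : ℂ) := by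
    simp only [dC, wordProd_one]
    rw [show (1 : H →L[ℂ] H) v = v from rfl, inner_self_eq_norm_sq_to_K]
    push_cast; rfl
  have hts : ∀ k, truncSum c X k = truncSum (dC C v) X k -
      (if k = 0 then ((‖v‖ ^ 2 / 2 : ℝ) : ℂ) • (1 : K →L[ℂ] K) else 0) := by
    intro k
    rcases Nat.eq_zero_or_pos k with rfl | hk
    · rw [truncSum_zero, truncSum_zero, hc1, hd1, if_pos rfl, ← sub_smul]
      congr 1
      push_cast; ring
    · rw [if_neg hk.ne', sub_zero]
      refine Finset.sum_congr rfl fun f _ => ?_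
      rw [hc _ (by rw [wordLen_word]; exact hk)]
  have hhas : HasSum (truncSum c X) ((∑' k, truncSum (dC C v) X k) -
      ((‖v‖ ^ 2 / 2 : ℝ) : ℂ) • (1 : K →L[ℂ] K)) := by
    rw [funext hts]
    exact hsum.hasSum.sub (hasSum_ite_eq 0 _)
  have hhol : holOp c X = _ := hhas.tsum_eq
  have hre : ∀ x : K, 0 ≤ (⟪x, holOp c X x⟫_ℂ).re := by
    intro x
    have hT : Tendsto (fun N => ∑ k ∈ Finset.range N, ⟪x ⊗ₜ[ℂ] v, (RR X C ^ k) (x ⊗ₜ[ℂ] v)⟫_ℂ)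
        atTop (nhds ⟪x, (∑' k, truncSum (dC C v) X k) x⟫_ℂ) := by
      simp only [← hinner]
      have h1 := hsum.hasSum.tendsto_sum_nat
      have hcont : Continuous fun A : K →L[ℂ] K => ⟪x, A x⟫_ℂ := by fun_prop
      have h2 := (hcont.tendsto _).comp h1
      refine h2.congr fun N => ?_
      simp [_root_.sum_apply, inner_sum]
    have h3 := neumann_pos (RR X C) (√q) (Real.sqrt_nonneg _) hr1 hR (x ⊗ₜ[ℂ] v) _ hT
    rw [TensorProduct.norm_tmul] at h3
    rw [hhol]
    simp only [_root_.sub_apply, _root_.smul_apply, inner_sub_right,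
      inner_smul_right, Complex.sub_re, Complex.re_ofReal_mul]
    have h4 : (⟪x, (1 : K →L[ℂ] K) x⟫_ℂ).re = ‖x‖ ^ 2 := inner_self_eq_norm_sq (𝕜 := ℂ) x
    rw [h4]
    nlinarith
  exact isPos_add_adj _ hre

end suff

section gram
variable {E E' : Type} [NormedAddCommGroup E] [InnerProductSpace ℂ E]
  [NormedAddCommGroup E'] [InnerProductSpace ℂ E']

lemma gram_ext {ι : Type} [Fintype ι] (u : ι → E) (w : ι → E')
    (h : ∀ p q, ⟪u p, u q⟫_ℂ = ⟪w p, w q⟫_ℂ) :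
    ∃ W : E →L[ℂ] E', ‖W‖ ≤ 1 ∧ ∀ p, W (u p) = w p := by
  classical
  let U := Fintype.linearCombination ℂ u
  let V := Fintype.linearCombination ℂ w
  have hn : ∀ l, ‖V l‖ = ‖U l‖ := by
    intro l
    have : ‖V l‖ ^ 2 = ‖U l‖ ^ 2 := by
      rw [nsq, nsq]
      simp only [U, V, Fintype.linearCombination_apply, sum_inner, inner_sum, inner_smul_left,
        inner_smul_right, h]
    exact (pow_left_inj₀ (norm_nonneg _) (norm_nonneg _) two_ne_zero).1 this
  obtain ⟨s, hs⟩ := U.rangeRestrict.exists_rightInverse_of_surjective U.range_rangeRestrict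
  have hs' : ∀ x, U (s x) = x := fun x => by
    have := congrArg Subtype.val (LinearMap.congr_fun hs x)
    simpa using this
  let W0 : LinearMap.range U →L[ℂ] E' := (V ∘ₗ s).mkContinuous 1 (fun x => by
    rw [LinearMap.comp_apply, hn, hs', one_mul]; rfl)
  have hW0 : ‖W0‖ ≤ 1 := LinearMap.mkContinuous_norm_le _ zero_le_one _
  have hW0u : ∀ l, W0 ⟨U l, LinearMap.mem_range_self U l⟩ = V l := by
    intro l
    change V (s _) = V l
    rw [← sub_eq_zero, ← map_sub, ← norm_eq_zero, hn, map_sub, hs', sub_self, norm_zero]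
  refine ⟨W0 ∘L (LinearMap.range U).orthogonalProjection, ?_, fun p => ?_⟩
  · refine (opNorm_comp_le _ _).trans ?_
    exact mul_le_one₀ hW0 (norm_nonneg _) (Submodule.orthogonalProjection_norm_le _)
  · have hu : U (Pi.single p 1) = u p := by simp [U, Fintype.linearCombination_apply_single]
    have hv : V (Pi.single p 1) = w p := by simp [V, Fintype.linearCombination_apply_single]
    have := hW0u (Pi.single p 1)
    rw [hv] at this
    rw [ContinuousLinearMap.comp_apply, ← this]
    congr 1
    ext
    rw [Submodule.coe_orthogonalProjection_apply, Submodule.starProjection_eq_self_iff.2]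
    · exact hu.symm
    · rw [← hu]; exact LinearMap.mem_range_self U _

/-- Abstract dilation step: a system of vectors with right-Toeplitz Gram matrix. -/
lemma exists_col [CompleteSpace E] {n : ℕ} (m : ℕ) (v : Word n → E)
    (hv : ∀ (i j : Fin n) (a c : Word n), wordLen a < m → wordLen c < m →
      ⟪v (a * FreeMonoid.of i), v (c * FreeMonoid.of j)⟫_ℂ = if i = j then ⟪v a, v c⟫_ℂ else 0) :
    ∃ C : Fin n → E →L[ℂ] E, (∀ h, ∑ i, ‖C i h‖ ^ 2 ≤ ‖h‖ ^ 2) ∧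
      ∀ i h a, wordLen a < m → ⟪C i h, v a⟫_ℂ = ⟪h, v (a * FreeMonoid.of i)⟫_ℂ := by
  classical
  have hfin : Finite {a : Word n // wordLen a < m} := by
    have := List.finite_length_lt (Fin n) m
    exact this.to_subtype
  have := Fintype.ofFinite {a : Word n // wordLen a < m}
  obtain ⟨W, hW, hWu⟩ := gram_ext (ι := Fin n × {a : Word n // wordLen a < m})
    (E := PiLp 2 (fun _ : Fin n => E)) (E' := E)
    (fun p => WithLp.toLp 2 (Pi.single p.1 (v p.2.1)))
    (fun p => v (p.2.1 * FreeMonoid.of p.1)) (by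
      rintro ⟨i, a, ha⟩ ⟨j, c, hc⟩
      rw [hv i j a c ha hc, PiLp.inner_apply]
      rw [Finset.sum_eq_single i]
      · by_cases hij : i = j
        · subst hij; simp
        · simp [hij, Pi.single_apply]
      · intro k _ hk
        simp [Pi.single_apply, hk]
      · simp)
  refine ⟨fun i => PiLp.proj 2 (fun _ : Fin n => E) i ∘L adjoint W, fun h => ?_, fun i h a ha => ?_⟩
  · have h1 : ‖adjoint W h‖ ≤ ‖h‖ := by
      refine (le_opNorm _ _).trans ?_
      rw [LinearIsometryEquiv.norm_map]
      exact mul_le_of_le_one_left (norm_nonneg _) hW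
    have h2 := PiLp.norm_sq_eq_of_L2 (fun _ : Fin n => E) (adjoint W h)
    calc _ = ‖adjoint W h‖ ^ 2 := h2.symm
      _ ≤ _ := by gcongr
  · have h3 := hWu (i, ⟨a, ha⟩)
    dsimp only at h3
    rw [← h3, ← adjoint_inner_left, PiLp.inner_apply, Finset.sum_eq_single i]
    · simp
    · intro k _ hk
      simp [Pi.single_apply, hk]
    · simp

lemma col_word {n : ℕ} (m : ℕ) (v : Word n → E) (C : Fin n → E →L[ℂ] E)
    (hC : ∀ i h a, wordLen a < m → ⟪C i h, v a⟫_ℂ = ⟪h, v (a * FreeMonoid.of i)⟫_ℂ)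
    (h : E) (α : Word n) : ∀ β, wordLen β + wordLen α ≤ m →
      ⟪wordProd C α h, v β⟫_ℂ = ⟪h, v (β * α)⟫_ℂ := by
  induction α using FreeMonoid.inductionOn' with
  | one => intro β _; simp [wordProd_one]
  | of_mul i α ih =>
    intro β hβ
    rw [wordLen_mul, wordLen_of] at hβ
    rw [wordProd_of_mul, clm_mul_apply, hC _ _ _ (by omega), ih _ (by
      rw [wordLen_mul, wordLen_of]; omega), mul_assoc]

end gram

section kernel
open scoped Classical
variable {n : ℕ} (m : ℕ) {F : Type} [NormedAddCommGroup F] [InnerProductSpace ℂ F]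
  [CompleteSpace F] (e : HilbertBasis (Word n) ℂ F) (Sm : Fin n → F →L[ℂ] F)
  (hSm : ∀ (i : Fin n) (α : Word n),
      Sm i (e α) = if wordLen α < m then e (FreeMonoid.of i * α) else 0)
include hSm

lemma wordProd_Sm (α β : Word n) (hβ : wordLen β ≤ m ∨ 1 ≤ wordLen α) :
    wordProd Sm α (e β) = if wordLen α + wordLen β ≤ m then e (α * β) else 0 := by
  induction α using FreeMonoid.inductionOn' generalizing β with
  | one =>
    rw [wordLen_one] at hβ
    have : wordLen β ≤ m := by omega
    simp [wordProd_one, wordLen_one, this]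
  | of_mul i a ih =>
    rw [wordProd_of_mul, clm_mul_apply]
    by_cases ha : wordLen β ≤ m ∨ 1 ≤ wordLen a
    · rw [ih β ha, wordLen_mul, wordLen_of]
      by_cases h1 : wordLen a + wordLen β ≤ m
      · rw [if_pos h1, hSm, wordLen_mul, mul_assoc]
        by_cases h2 : wordLen a + wordLen β < m
        · rw [if_pos h2, if_pos (by omega)]
        · rw [if_neg h2, if_neg (by omega)]
      · rw [if_neg h1, if_neg (by omega), map_zero]
    · push Not at ha
      have : a = 1 := wordLen_eq_zero (by omega)
      subst this
      have h3 : wordProd Sm (1 : Word n) (e β) = e β := by rw [wordProd_one]; rfl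
      rw [h3, hSm, wordLen_mul, wordLen_of, if_neg (by omega), if_neg (by omega)]

lemma inner_wordProd (α β γ : Word n) (hβ : wordLen β ≤ m) (hγ : wordLen γ ≤ m) :
    ⟪e γ, wordProd Sm α (e β)⟫_ℂ = if γ = α * β then 1 else 0 := by
  rw [wordProd_Sm m e Sm hSm α β (Or.inl hβ)]
  split_ifs with h1 h2 h2
  · rw [h2, inner_self_eq_norm_sq_to_K, e.orthonormal.1]; simp
  · exact e.orthonormal.2 h2
  · exfalso; rw [h2, wordLen_mul] at hγ; omega
  · simp

lemma inner_truncSum (b : Word n → ℂ) (k : ℕ) (β γ : Word n) (hβ : wordLen β ≤ m)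
    (hγ : wordLen γ ≤ m) :
    ⟪e γ, truncSum b Sm k (e β)⟫_ℂ
      = ∑ f : Fin k → Fin n, if γ = word f * β then b (word f) else 0 := by
  rw [truncSum, _root_.sum_apply, inner_sum]
  refine Finset.sum_congr rfl fun f _ => ?_
  rw [_root_.smul_apply, inner_smul_right, inner_wordProd m e Sm hSm _ _ _ hβ hγ]
  simp

lemma inner_truncSumAdj (b : Word n → ℂ) (k : ℕ) (β γ : Word n) (hβ : wordLen β ≤ m)
    (hγ : wordLen γ ≤ m) :
    ⟪e γ, truncSumAdj b Sm k (e β)⟫_ℂ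
      = ∑ f : Fin k → Fin n, if β = word f * γ then b (word f) else 0 := by
  rw [truncSumAdj, _root_.sum_apply, inner_sum]
  refine Finset.sum_congr rfl fun f _ => ?_
  rw [_root_.smul_apply, inner_smul_right, adjoint_inner_right, ← inner_conj_symm,
    inner_wordProd m e Sm hSm _ _ _ hγ hβ]
  split_ifs <;> simp

lemma truncSum_big (b : Word n → ℂ) (k : ℕ) (hk : m < k) : truncSum b Sm k = 0 := by
  have : ∀ f : Fin k → Fin n, wordProd Sm (word f) = 0 := by
    intro f
    refine ContinuousLinearMap.ext_on (s := Set.range e) ?_ ?_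
    · exact Submodule.dense_iff_topologicalClosure_eq_top.2 e.dense_span
    · rintro _ ⟨β, rfl⟩
      rw [wordProd_Sm m e Sm hSm _ β (Or.inr (by rw [wordLen_word]; omega)), wordLen_word,
        if_neg (by omega)]
      simp
  simp [truncSum, this]

lemma Sm_row (h : F) : ∑ i, ‖adjoint (Sm i) h‖ ^ 2 ≤ ‖h‖ ^ 2 := by
  classical
  have hs : ∀ y : F, HasSum (fun α => ‖⟪e α, y⟫_ℂ‖ ^ 2) (‖y‖ ^ 2) := by
    intro y
    have h1 := (e.hasSum_inner_mul_inner y y).mapL Complex.reCLM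
    convert h1 using 1
    · ext α
      rw [← inner_conj_symm y (e α), mul_comm, Complex.mul_conj]
      simp [Complex.normSq_eq_norm_sq, ← Complex.ofReal_pow]
    · rw [inner_self_eq_norm_sq_to_K]
      simp [← Complex.ofReal_pow]
  have h2 := hasSum_sum (s := Finset.univ) (fun i (_ : i ∈ Finset.univ) => hs (adjoint (Sm i) h))
  refine hasSum_le_of_sum_le h2 fun s => ?_
  have ho : Orthonormal ℂ (fun p : Word n × Fin n => e (FreeMonoid.of p.2 * p.1)) := by
    refine e.orthonormal.comp (fun p : Word n × Fin n => FreeMonoid.of p.2 * p.1) ?_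
    rintro ⟨a, i⟩ ⟨c, j⟩ hh
    have := congrArg FreeMonoid.toList hh
    simp at this
    simp [this]
  have h3 := ho.sum_inner_products_le h (s := s ×ˢ Finset.univ)
  rw [Finset.sum_product] at h3
  refine le_trans ?_ h3
  refine Finset.sum_le_sum fun α _ => Finset.sum_le_sum fun i _ => ?_
  rw [adjoint_inner_right, hSm]
  split_ifs
  · rfl
  · simp

lemma Sm_ball (r : ℝ) (hr : 0 ≤ r) (hr1 : r < 1) : inBall 1 (fun i => (r : ℂ) • Sm i) := by
  have h1 := row_bound (fun i => (r : ℂ) • Sm i) r hr (fun x => by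
    have h2 : ∀ i, ‖adjoint ((r : ℂ) • Sm i) x‖ ^ 2 = r ^ 2 * ‖adjoint (Sm i) x‖ ^ 2 := by
      intro i
      rw [LinearIsometryEquiv.map_smulₛₗ, _root_.smul_apply, norm_smul, mul_pow]
      simp
    simp only [h2, ← Finset.mul_sum]
    gcongr
    exact Sm_row m e Sm hSm x)
  unfold inBall
  refine h1.trans_lt ?_
  nlinarith

omit [CompleteSpace F] hSm in
lemma wordProd_smul (r : ℂ) (α : Word n) :
    wordProd (fun i => r • Sm i) α = r ^ wordLen α • wordProd Sm α := by
  induction α using FreeMonoid.inductionOn' with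
  | one => simp [wordProd_one, wordLen_one]
  | of_mul i a ih =>
    rw [wordProd_of_mul, wordProd_of_mul, ih, wordLen_mul, wordLen_of, smul_mul_smul_comm,
      pow_add, pow_one]

omit [CompleteSpace F] hSm in
lemma truncSum_smul (r : ℂ) (c : Word n → ℂ) (k : ℕ) :
    truncSum c (fun i => r • Sm i) k = r ^ k • truncSum c Sm k := by
  simp only [truncSum, wordProd_smul, wordLen_word, Finset.smul_sum]
  exact Finset.sum_congr rfl fun f _ => smul_comm _ _ _

lemma holOp_Sm (r : ℂ) (c : Word n → ℂ) :
    holOp c (fun i => r • Sm i) = ∑ k ∈ Finset.range (m + 1), r ^ k • truncSum c Sm k := by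
  rw [holOp, tsum_eq_sum (s := Finset.range (m + 1))]
  · exact Finset.sum_congr rfl fun k _ => truncSum_smul Sm r c k
  · intro k hk
    rw [truncSum_smul, truncSum_big m e Sm hSm c k (by simpa using hk), smul_zero]

omit [CompleteSpace F] hSm in
lemma truncSum_congr (c d : Word n → ℂ) (k : ℕ) (h : ∀ α, wordLen α = k → c α = d α) :
    truncSum c Sm k = truncSum d Sm k :=
  Finset.sum_congr rfl fun f _ => by rw [h _ (wordLen_word f)]

omit hSm in
lemma Q_eq (b : Word n → ℂ) (hb0 : (b 1).im = 0) :
    ((∑ k ∈ Finset.Icc 1 m, truncSumAdj (fun α => (starRingEnd ℂ) (b α)) Sm k) +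
        b 1 • (1 : F →L[ℂ] F) +
        ∑ k ∈ Finset.Icc 1 m, truncSum b Sm k) =
    ((b 1 / 2) • (1 : F →L[ℂ] F) + ∑ k ∈ Finset.Icc 1 m, truncSum b Sm k) +
      adjoint ((b 1 / 2) • (1 : F →L[ℂ] F) + ∑ k ∈ Finset.Icc 1 m, truncSum b Sm k) := by
  have h1 : adjoint ((b 1 / 2) • (1 : F →L[ℂ] F)) = (b 1 / 2) • (1 : F →L[ℂ] F) := by
    rw [LinearIsometryEquiv.map_smulₛₗ, ← star_eq_adjoint, star_one]
    congr 1
    rw [map_div₀, Complex.conj_eq_iff_im.2 hb0, Complex.conj_ofNat]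
  rw [map_add, h1, map_sum]
  simp only [adjoint_truncSum]
  have h2 : b 1 • (1 : F →L[ℂ] F) = (b 1 / 2) • (1 : F →L[ℂ] F) + (b 1 / 2) • (1 : F →L[ℂ] F) := by
    rw [← add_smul, add_halves]
  rw [h2]
  abel

lemma dir1 (b : Word n → ℂ) (hb0 : (b 1).im = 0) (c : Word n → ℂ) (hc1 : c 1 = b 1 / 2)
    (hc : ∀ α : Word n, 1 ≤ wordLen α → wordLen α ≤ m → c α = b α)
    (hpos : ∀ X : Fin n → F →L[ℂ] F, inBall 1 X → (holOp c X + adjoint (holOp c X)).IsPositive) :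
    ((∑ k ∈ Finset.Icc 1 m, truncSumAdj (fun α => (starRingEnd ℂ) (b α)) Sm k) +
        b 1 • (1 : F →L[ℂ] F) +
        ∑ k ∈ Finset.Icc 1 m, truncSum b Sm k).IsPositive := by
  have hG : (b 1 / 2) • (1 : F →L[ℂ] F) + ∑ k ∈ Finset.Icc 1 m, truncSum b Sm k =
      ∑ k ∈ Finset.range (m + 1), truncSum c Sm k := by
    rw [Finset.sum_range_succ', truncSum_zero, hc1, add_comm]
    congr 1
    rw [Finset.range_eq_Ico, Finset.sum_Ico_add' (fun k => truncSum c Sm k) 0 m 1]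
    refine Finset.sum_congr (by ext x; rw [Finset.mem_Icc, Finset.mem_Ico]; omega) fun k hk => ?_
    have hk' := Finset.mem_Ico.1 hk
    exact truncSum_congr Sm _ _ k fun α hα => (hc α (by omega) (by omega)).symm
  rw [Q_eq m Sm b hb0, hG]
  refine isPos_add_adj _ fun x => ?_
  let φ : ℝ → ℝ := fun r =>
    (∑ k ∈ Finset.range (m + 1), (r : ℂ) ^ k * ⟪x, truncSum c Sm k x⟫_ℂ).re
  have hφ : Continuous φ := by fun_prop
  have h1 : Tendsto φ (nhdsWithin 1 (Set.Iio 1)) (nhds (φ 1)) :=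
    (hφ.tendsto 1).mono_left nhdsWithin_le_nhds
  have h2 : 0 ≤ φ 1 := by
    refine ge_of_tendsto h1 ?_
    filter_upwards [Ioo_mem_nhdsLT (show (0 : ℝ) < 1 by norm_num)] with r hr
    have h3 := re_of_isPos_add_adj _ (hpos _ (Sm_ball m e Sm hSm r hr.1.le hr.2)) x
    rw [holOp_Sm m e Sm hSm] at h3
    simpa only [_root_.sum_apply, _root_.smul_apply, inner_sum, inner_smul_right] using h3
  simpa [φ, _root_.sum_apply, inner_sum] using h2

lemma Q_inner (b : Word n → ℂ) (β γ : Word n) (hβ : wordLen β ≤ m) (hγ : wordLen γ ≤ m) :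
    ⟪e γ, ((∑ k ∈ Finset.Icc 1 m, truncSumAdj (fun α => (starRingEnd ℂ) (b α)) Sm k) +
        b 1 • (1 : F →L[ℂ] F) +
        ∑ k ∈ Finset.Icc 1 m, truncSum b Sm k) (e β)⟫_ℂ =
    (∑ k ∈ Finset.Icc 1 m, ∑ f : Fin k → Fin n,
      if β = word f * γ then (starRingEnd ℂ) (b (word f)) else 0) +
    (if γ = β then b 1 else 0) +
    (∑ k ∈ Finset.Icc 1 m, ∑ f : Fin k → Fin n, if γ = word f * β then b (word f) else 0) := by
  simp only [_root_.add_apply, inner_add_right, _root_.sum_apply, inner_sum,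
    inner_truncSum m e Sm hSm b _ β γ hβ hγ, inner_truncSumAdj m e Sm hSm _ _ β γ hβ hγ]
  congr 2
  have h1 : (1 : F →L[ℂ] F) (e β) = e β := rfl
  rw [_root_.smul_apply, inner_smul_right, h1, orthonormal_iff_ite.1 e.orthonormal]
  simp

omit [CompleteSpace F] hSm [NormedAddCommGroup F] [InnerProductSpace ℂ F] in
lemma word_cancel (i j : Fin n) (a c : Word n) :
    a * FreeMonoid.of i = c * FreeMonoid.of j ↔ i = j ∧ a = c := by
  constructor
  · intro h
    have := congrArg FreeMonoid.toList h
    simp only [FreeMonoid.toList_mul, FreeMonoid.toList_of] at this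
    have h2 := List.append_inj' this rfl
    exact ⟨by simpa using h2.2, FreeMonoid.toList.injective h2.1⟩
  · rintro ⟨rfl, rfl⟩; rfl

lemma dir2 (b : Word n → ℂ) (hb0 : (b 1).im = 0) (hb0' : 0 ≤ (b 1).re)
    (hQ : ((∑ k ∈ Finset.Icc 1 m, truncSumAdj (fun α => (starRingEnd ℂ) (b α)) Sm k) +
        b 1 • (1 : F →L[ℂ] F) +
        ∑ k ∈ Finset.Icc 1 m, truncSum b Sm k).IsPositive) :
    ∃ c : Word n → ℂ, c 1 = b 1 / 2 ∧
        (∀ α : Word n, 1 ≤ wordLen α → wordLen α ≤ m → c α = b α) ∧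
        radCond 1 c ∧
        ∀ (K : Type) [NormedAddCommGroup K] [InnerProductSpace ℂ K] [CompleteSpace K]
          (X : Fin n → K →L[ℂ] K), inBall 1 X →
            (holOp c X + adjoint (holOp c X)).IsPositive := by
  have hI := Q_inner m e Sm hSm b
  set Q := (∑ k ∈ Finset.Icc 1 m, truncSumAdj (fun α => (starRingEnd ℂ) (b α)) Sm k) +
        b 1 • (1 : F →L[ℂ] F) + ∑ k ∈ Finset.Icc 1 m, truncSum b Sm k with hQdef
  have hQ0 : 0 ≤ Q := (nonneg_iff_isPositive Q).2 hQ
  obtain ⟨B, hBa, hBB⟩ : ∃ B : F →L[ℂ] F, adjoint B = B ∧ B * B = Q :=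
    ⟨CFC.sqrt Q, (CFC.sqrt_nonneg Q).isSelfAdjoint, CFC.sqrt_mul_sqrt_self Q hQ0⟩
  have hv : ∀ γ β, ⟪B (e γ), B (e β)⟫_ℂ = ⟪e γ, Q (e β)⟫_ℂ := by
    intro γ β
    rw [← hBB, clm_mul_apply, ← adjoint_inner_left B (B (e β)), hBa]
  obtain ⟨C, hC, hCv⟩ := exists_col m (fun α => B (e α)) (by
    intro i j a c ha hc
    simp only [hv]
    rw [hI _ _ (by rw [wordLen_mul, wordLen_of]; omega) (by rw [wordLen_mul, wordLen_of]; omega),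
      hI _ _ hc.le ha.le]
    simp only [← mul_assoc, word_cancel]
    by_cases hij : i = j
    · subst hij; simp
    · simp [hij, Ne.symm hij])
  have hone : ∀ {k : ℕ}, 1 ≤ k → ∀ (f : Fin k → Fin n) (α : Word n), 1 ≠ word f * α := by
    intro k hk f α h
    have := congrArg wordLen h
    rw [wordLen_mul, wordLen_word, wordLen_one] at this
    omega
  have hb1 : ⟪B (e 1), B (e 1)⟫_ℂ = b 1 := by
    rw [hv, hI _ _ (by simp [wordLen_one]) (by simp [wordLen_one]), if_pos rfl]
    rw [Finset.sum_eq_zero, Finset.sum_eq_zero, zero_add, add_zero]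
    · intro k hk
      exact Finset.sum_eq_zero fun f _ => if_neg (hone (Finset.mem_Icc.1 hk).1 f 1)
    · intro k hk
      exact Finset.sum_eq_zero fun f _ => if_neg (hone (Finset.mem_Icc.1 hk).1 f 1)
  have hbα : ∀ α : Word n, 1 ≤ wordLen α → wordLen α ≤ m → ⟪B (e α), B (e 1)⟫_ℂ = b α := by
    intro α h1 h2
    have hα : α ≠ 1 := by rintro rfl; rw [wordLen_one] at h1; omega
    rw [hv, hI _ _ (by simp [wordLen_one]) h2, if_neg hα]
    rw [Finset.sum_eq_zero, zero_add, zero_add]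
    · simp only [mul_one]
      rw [Finset.sum_eq_single (wordLen α)]
      · obtain ⟨f0, hg⟩ : ∃ f0 : Fin (wordLen α) → Fin n, word f0 = α :=
          ⟨(FreeMonoid.toList α).get, by
            have : word (FreeMonoid.toList α).get = α := by simp [word]
            exact this⟩
        rw [Finset.sum_eq_single f0]
        · rw [hg, if_pos rfl]
        · intro f _ hf
          refine if_neg fun h => hf ?_
          have h4 : word f0 = word f := hg.trans h
          exact (List.ofFn_injective (FreeMonoid.ofList.injective h4)).symm
        · simp
      · intro k _ hk
        refine Finset.sum_eq_zero fun f _ => if_neg fun h => hk ?_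
        rw [h, wordLen_word]
      · intro h
        exact absurd (Finset.mem_Icc.2 ⟨h1, h2⟩) h
    · intro k hk
      exact Finset.sum_eq_zero fun f _ => if_neg (hone (Finset.mem_Icc.1 hk).1 f α)
  have hd : ∀ α : Word n, wordLen α ≤ m → dC C (B (e 1)) α = ⟪B (e α), B (e 1)⟫_ℂ := by
    intro α h
    have h5 := col_word m (fun α => B (e α)) C hCv (B (e 1)) α 1 (by rw [wordLen_one]; omega)
    simp only [one_mul] at h5
    rw [dC, ← inner_conj_symm, h5, inner_conj_symm]
  have hne : ∀ α : Word n, 1 ≤ wordLen α → α ≠ 1 := by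
    rintro α h rfl; rw [wordLen_one] at h; omega
  refine ⟨fun α => if α = 1 then b 1 / 2 else dC C (B (e 1)) α, by simp, ?_, ?_, ?_⟩
  · intro α h1 h2
    simp only [if_neg (hne α h1)]
    rw [hd α h2, hbα α h1 h2]
  · exact radCond_of C (B (e 1)) hC _ fun α h => if_neg (hne α h)
  · intro K _ _ _ X hX
    refine pos_of C (B (e 1)) hC _ (fun α h => if_neg (hne α h)) ?_ K X hX
    rw [if_pos rfl, ← hb1, inner_self_eq_norm_sq_to_K]
    simp

end kernel
/-- Carathéodory interpolation for free holomorphic functions with positive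
real part: the data `(b_α)_{|α| ≤ m}` (with `b_{g₀} ≥ 0`) extends to a free holomorphic
function `g(X) = b_{g₀}/2 + Σ_{|α| ≥ 1} b_α X_α` with positive real part on the unit ball iff
`Σ_{1 ≤ |α| ≤ m} conj(b_α) (S_α^{(m)})* + b_{g₀} I + Σ_{1 ≤ |α| ≤ m} b_α S_α^{(m)} ≥ 0`.
(Here `Sm i` is the compression `S_i^{(m)}` of the left creation operator to polynomials of
degree `≤ m`, extended by `0`.) -/
theorem stmt_16 (n : ℕ) (hn : 1 ≤ n) (m : ℕ)
    (F : Type) [NormedAddCommGroup F] [InnerProductSpace ℂ F] [CompleteSpace F]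
    (e : HilbertBasis (Word n) ℂ F)
    (Sm : Fin n → F →L[ℂ] F)
    (hSm : ∀ (i : Fin n) (α : Word n),
      Sm i (e α) = if wordLen α < m then e (FreeMonoid.of i * α) else 0)
    (b : Word n → ℂ) (hb0 : (b 1).im = 0) (hb0' : 0 ≤ (b 1).re) :
    (∃ c : Word n → ℂ, c 1 = b 1 / 2 ∧
        (∀ α : Word n, 1 ≤ wordLen α → wordLen α ≤ m → c α = b α) ∧
        radCond 1 c ∧
        ∀ (K : Type) [NormedAddCommGroup K] [InnerProductSpace ℂ K] [CompleteSpace K]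
          (X : Fin n → K →L[ℂ] K), inBall 1 X →
            (holOp c X + adjoint (holOp c X)).IsPositive) ↔
    ((∑ k ∈ Finset.Icc 1 m, truncSumAdj (fun α => (starRingEnd ℂ) (b α)) Sm k) +
        b 1 • (1 : F →L[ℂ] F) +
        ∑ k ∈ Finset.Icc 1 m, truncSum b Sm k).IsPositive := by
  constructor
  · rintro ⟨c, hc1, hc, -, hpos⟩
    exact dir1 m e Sm hSm b hb0 c hc1 hc (fun X hX => hpos F X hX)
  · intro hQ
    exact dir2 m e Sm hSm b hb0 hb0' hQ

end
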